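/- Let N and T be cocommutative Hopf algebras over a field k and let A be a commutative k-algebra viewed as a trivial module. For the tensor product Hopf algebra N⊗T (the smash product with trivial action of T on N), there is a canonical isomorphism H²(N⊗T,A) ≅ H²(T,A) ⊕ H¹_meas(T,Hom(N,A)) ⊕ H²(N,A), where H¹_meas is computed with respect to the trivial action; explicitly, it is given by [f] ↦ ([f|_{T⊗T}], f̃, [f|_{N⊗N}]) with f̃(t⊗n) = ∑ f(t_(1)⊗n_(1)) f^{-1}(n_(2)⊗t_(2)). -/

import Mathlib

open TensorProduct

namespace SmashPaper

variable (k : Type) [Field k]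

section Conv

variable {k : Type} [Field k] {C A : Type} [AddCommGroup C] [Module k C] [Coalgebra k C]
  [CommRing A] [Algebra k A]

/-- Convolution product on linear maps from a coalgebra to an algebra. -/
noncomputable def conv (f g : C →ₗ[k] A) : C →ₗ[k] A :=
  LinearMap.mul' k A ∘ₗ TensorProduct.map f g ∘ₗ Coalgebra.comul

/-- Convolution unit. -/
noncomputable def convOne (C A : Type) [AddCommGroup C] [Module k C] [Coalgebra k C]
    [CommRing A] [Algebra k A] : C →ₗ[k] A :=
  Algebra.linearMap k A ∘ₗ Coalgebra.counit

def IsConvInv (f g : C →ₗ[k] A) : Prop :=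
  conv f g = convOne C A ∧ conv g f = convOne C A

def IsConvInvertible (f : C →ₗ[k] A) : Prop := ∃ g, IsConvInv f g

end Conv

/-- Cocommutativity of a coalgebra. -/
def IsCocomm (C : Type) [AddCommGroup C] [Module k C] [Coalgebra k C] : Prop :=
  (TensorProduct.comm k C C).toLinearMap ∘ₗ Coalgebra.comul
    = (Coalgebra.comul : C →ₗ[k] C ⊗[k] C)

section Drop

variable {k : Type} [Field k] (C D : Type) [AddCommGroup C] [Module k C]
  [AddCommGroup D] [Module k D]

/-- `c ⊗ d ↦ ε(c) d`. -/
noncomputable def dropL [Coalgebra k C] : C ⊗[k] D →ₗ[k] D :=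
  (TensorProduct.lid k D).toLinearMap ∘ₗ LinearMap.rTensor D (Coalgebra.counit (R := k))

/-- `c ⊗ d ↦ ε(d) c`. -/
noncomputable def dropR [Coalgebra k D] : C ⊗[k] D →ₗ[k] C :=
  (TensorProduct.rid k C).toLinearMap ∘ₗ LinearMap.lTensor C (Coalgebra.counit (R := k))

end Drop

section Sweedler

variable {k : Type} [Field k] (H A : Type) [Ring H] [Bialgebra k H]
  [CommRing A] [Algebra k A]

variable {H A}

/-- Normalization for 1-cochains. -/
def Normalized1 (t : H →ₗ[k] A) : Prop := t 1 = 1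

/-- Normalization for 2-cochains: trivial whenever an argument is a scalar. -/
def Normalized2 (f : H ⊗[k] H →ₗ[k] A) : Prop :=
  ∀ x : H, f (1 ⊗ₜ[k] x) = algebraMap k A (Coalgebra.counit x)
    ∧ f (x ⊗ₜ[k] 1) = algebraMap k A (Coalgebra.counit x)

/-- Normalization for 3-cochains. -/
def Normalized3 (f : (H ⊗[k] H) ⊗[k] H →ₗ[k] A) : Prop :=
  ∀ x y : H,
    f ((1 ⊗ₜ[k] x) ⊗ₜ[k] y) = algebraMap k A (Coalgebra.counit x * Coalgebra.counit y)
    ∧ f ((x ⊗ₜ[k] 1) ⊗ₜ[k] y) = algebraMap k A (Coalgebra.counit x * Coalgebra.counit y)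
    ∧ f ((x ⊗ₜ[k] y) ⊗ₜ[k] 1) = algebraMap k A (Coalgebra.counit x * Coalgebra.counit y)

/-- `∑ f(x₍₁₎ ⊗ y₍₁₎) f(x₍₂₎y₍₂₎ ⊗ z)` as a linear map on `(H ⊗ H) ⊗ H`. -/
noncomputable def cocycle2LHS (f : H ⊗[k] H →ₗ[k] A) : (H ⊗[k] H) ⊗[k] H →ₗ[k] A :=
  conv (f ∘ₗ dropR (H ⊗[k] H) H) (f ∘ₗ LinearMap.rTensor H (LinearMap.mul' k H))

/-- `∑ f(y₍₁₎ ⊗ z₍₁₎) f(x ⊗ y₍₂₎z₍₂₎)` as a linear map on `(H ⊗ H) ⊗ H`. -/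
noncomputable def cocycle2RHS (f : H ⊗[k] H →ₗ[k] A) : (H ⊗[k] H) ⊗[k] H →ₗ[k] A :=
  conv (f ∘ₗ dropL H (H ⊗[k] H) ∘ₗ (TensorProduct.assoc k H H H).toLinearMap)
       (f ∘ₗ LinearMap.lTensor H (LinearMap.mul' k H) ∘ₗ (TensorProduct.assoc k H H H).toLinearMap)

/-- Sweedler 2-cocycles (for the trivial action). -/
def IsZ2 (f : H ⊗[k] H →ₗ[k] A) : Prop :=
  Normalized2 f ∧ IsConvInvertible f ∧ cocycle2LHS f = cocycle2RHS f

/-- The Sweedler 2-coboundary `∑ t(y₍₁₎) t⁻¹(x₍₁₎y₍₂₎) t(x₍₂₎)` of a 1-cochain `t`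
with convolution inverse `tinv`. -/
noncomputable def cobound2 (t tinv : H →ₗ[k] A) : H ⊗[k] H →ₗ[k] A :=
  conv (t ∘ₗ dropL H H) (conv (tinv ∘ₗ LinearMap.mul' k H) (t ∘ₗ dropR H H))

/-- Sweedler 2-coboundaries (for the trivial action). -/
def IsB2 (f : H ⊗[k] H →ₗ[k] A) : Prop :=
  ∃ t tinv : H →ₗ[k] A, Normalized1 t ∧ IsConvInv t tinv ∧ f = cobound2 t tinv

/-- Two 2-cochains are cohomologous when they differ (in convolution) by a 2-coboundary. -/
def Cohomologous2 (f f' : H ⊗[k] H →ₗ[k] A) : Prop :=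
  ∃ b, IsB2 b ∧ f = conv f' b

/-- `(x⊗y)⊗z ↦ x ⊗ yz`. -/
noncomputable def m23 : (H ⊗[k] H) ⊗[k] H →ₗ[k] H ⊗[k] H :=
  LinearMap.lTensor H (LinearMap.mul' k H) ∘ₗ (TensorProduct.assoc k H H H).toLinearMap

/-- `(x⊗y)⊗z ↦ ε(x) (y⊗z)`. -/
noncomputable def p23 : (H ⊗[k] H) ⊗[k] H →ₗ[k] H ⊗[k] H :=
  dropL H (H ⊗[k] H) ∘ₗ (TensorProduct.assoc k H H H).toLinearMap

/-- 3-cocycle condition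
`∑ f(y₁⊗z₁⊗w₁) f(x₁⊗y₂z₂⊗w₂) f(x₂⊗y₃⊗z₃) = ∑ f(x₁y₁⊗z₁⊗w₁) f(x₂⊗y₂⊗z₂w₂)`. -/
def IsZ3cond (f : (H ⊗[k] H) ⊗[k] H →ₗ[k] A) : Prop :=
  conv (f ∘ₗ LinearMap.rTensor H (LinearMap.rTensor H (dropL H H)))
    (conv (f ∘ₗ LinearMap.rTensor H (m23 (H := H)))
          (f ∘ₗ dropR ((H ⊗[k] H) ⊗[k] H) H))
  = conv (C := ((H ⊗[k] H) ⊗[k] H) ⊗[k] H)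
         (f ∘ₗ LinearMap.rTensor H (LinearMap.rTensor H (LinearMap.mul' k H)))
         (f ∘ₗ (LinearMap.lTensor (H ⊗[k] H) (LinearMap.mul' k H)
              ∘ₗ (TensorProduct.assoc k (H ⊗[k] H) H H).toLinearMap :
                ((H ⊗[k] H) ⊗[k] H) ⊗[k] H →ₗ[k] (H ⊗[k] H) ⊗[k] H))

/-- Sweedler 3-cocycles (for the trivial action). -/
def IsZ3 (f : (H ⊗[k] H) ⊗[k] H →ₗ[k] A) : Prop :=
  Normalized3 f ∧ IsConvInvertible f ∧ IsZ3cond f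

/-- The Sweedler 3-coboundary
`∑ v(y₁⊗z₁) v⁻¹(x₁y₂⊗z₂) v(x₂⊗y₃z₃) v⁻¹(x₃⊗y₄)` of a 2-cochain `v`. -/
noncomputable def cobound3 (v vinv : H ⊗[k] H →ₗ[k] A) : (H ⊗[k] H) ⊗[k] H →ₗ[k] A :=
  conv (v ∘ₗ p23 (H := H))
    (conv (vinv ∘ₗ LinearMap.rTensor H (LinearMap.mul' k H))
      (conv (v ∘ₗ m23 (H := H)) (vinv ∘ₗ dropR (H ⊗[k] H) H)))

/-- Sweedler 3-coboundaries (for the trivial action). -/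
def IsB3 (f : (H ⊗[k] H) ⊗[k] H →ₗ[k] A) : Prop :=
  ∃ v vinv : H ⊗[k] H →ₗ[k] A, Normalized2 v ∧ IsConvInv v vinv ∧ f = cobound3 v vinv

/-- Cohomologous 3-cochains. -/
def Cohomologous3 (f f' : (H ⊗[k] H) ⊗[k] H →ₗ[k] A) : Prop :=
  ∃ b, IsB3 b ∧ f = conv f' b

end Sweedler

section Measuring

variable {k : Type} [Field k]
variable {C : Type} [AddCommGroup C] [Module k C] [Coalgebra k C]
variable {N : Type} [Ring N] [Bialgebra k N]
variable {A : Type} [CommRing A] [Algebra k A]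

/-- `(C, θ)` measures `N` to `A`:
`∑ θ(c₍₁₎ ⊗ n) θ(c₍₂₎ ⊗ n') = θ(c ⊗ nn')` and `θ(c ⊗ 1) = ε(c) 1`. -/
def Measures (θ : C ⊗[k] N →ₗ[k] A) : Prop :=
  (θ ∘ₗ LinearMap.lTensor C (LinearMap.mul' k N)
    = conv (θ ∘ₗ LinearMap.lTensor C (dropR N N)) (θ ∘ₗ LinearMap.lTensor C (dropL N N)))
  ∧ ∀ c : C, θ (c ⊗ₜ[k] (1 : N)) = algebraMap k A (Coalgebra.counit c)

end Measuring

section Action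

variable {k : Type} [Field k]
variable {T N : Type} [Ring T] [Bialgebra k T] [Ring N] [Bialgebra k N]

/-- `μ : T ⊗ N → N` makes `N` a left `T`-module bialgebra. -/
structure IsModuleBialgebra (μ : T ⊗[k] N →ₗ[k] N) : Prop where
  one_act : ∀ n : N, μ ((1 : T) ⊗ₜ[k] n) = n
  mul_act : ∀ (t s : T) (n : N), μ ((t * s) ⊗ₜ[k] n) = μ (t ⊗ₜ[k] μ (s ⊗ₜ[k] n))
  act_one : ∀ t : T, μ (t ⊗ₜ[k] (1 : N)) = algebraMap k N (Coalgebra.counit t)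
  act_mul : μ ∘ₗ LinearMap.lTensor T (LinearMap.mul' k N)
      = LinearMap.mul' k N ∘ₗ TensorProduct.map μ μ
          ∘ₗ (TensorProduct.tensorTensorTensorComm k T T N N).toLinearMap
          ∘ₗ LinearMap.rTensor (N ⊗[k] N) Coalgebra.comul
  comul_act : Coalgebra.comul ∘ₗ μ
      = TensorProduct.map μ μ
          ∘ₗ (TensorProduct.tensorTensorTensorComm k T T N N).toLinearMap
          ∘ₗ TensorProduct.map Coalgebra.comul Coalgebra.comul
  counit_act : ∀ (t : T) (n : N),
      Coalgebra.counit (R := k) (μ (t ⊗ₜ[k] n))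
        = Coalgebra.counit (R := k) t * Coalgebra.counit (R := k) n

/-- `t ⊗ n ↦ ∑ t₍₁₎(n) ⊗ t₍₂₎`. -/
noncomputable def smashCross (μ : T ⊗[k] N →ₗ[k] N) : T ⊗[k] N →ₗ[k] N ⊗[k] T :=
  TensorProduct.map μ LinearMap.id
    ∘ₗ (TensorProduct.assoc k T N T).symm.toLinearMap
    ∘ₗ LinearMap.lTensor T (TensorProduct.comm k T N).toLinearMap
    ∘ₗ (TensorProduct.assoc k T T N).toLinearMap
    ∘ₗ LinearMap.rTensor N Coalgebra.comul

variable {H : Type} [Ring H] [Bialgebra k H]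

/-- `H` is the smash product `N ⋊ T` along the action `μ`, with `N` and `T` included
as the Hopf subalgebras `N ⋊ 1` and `1 ⋊ T`; we identify `n ⋊ t = n t`. -/
structure IsSmashProduct (μ : T ⊗[k] N →ₗ[k] N) (iN : N →ₐc[k] H) (iT : T →ₐc[k] H) : Prop where
  act : IsModuleBialgebra μ
  injN : Function.Injective iN
  injT : Function.Injective iT
  /-- `n ⊗ t ↦ (n ⋊ 1)(1 ⋊ t)` is a linear isomorphism `N ⊗ T ≅ H` (`H` is the
  tensor product coalgebra `N ⊗ T`). -/
  bij : Function.Bijective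
    (LinearMap.mul' k H ∘ₗ TensorProduct.map (iN : N →ₗ[k] H) (iT : T →ₗ[k] H))
  /-- The smash relation `t n = ∑ t₍₁₎(n) t₍₂₎` in `H`. -/
  straighten : LinearMap.mul' k H ∘ₗ TensorProduct.map (iT : T →ₗ[k] H) (iN : N →ₗ[k] H)
      = LinearMap.mul' k H ∘ₗ TensorProduct.map (iN : N →ₗ[k] H) (iT : T →ₗ[k] H)
          ∘ₗ smashCross μ

end Action

section MeasCohomology

variable {k : Type} [Field k]
variable {T N : Type} [Ring T] [Bialgebra k T] [Ring N] [Bialgebra k N]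
variable {A : Type} [CommRing A] [Algebra k A]

/-- Normalization in the `T`-variable for measuring 1-cochains `T ⊗ N → A`. -/
def MeasNormalized1 (f : T ⊗[k] N →ₗ[k] A) : Prop :=
  ∀ n : N, f ((1 : T) ⊗ₜ[k] n) = algebraMap k A (Coalgebra.counit n)

/-- A measuring 1-cochain: an element of `Reg_meas(T, Hom(N,A))`. -/
def IsRegMeas1 (f : T ⊗[k] N →ₗ[k] A) : Prop :=
  Measures f ∧ MeasNormalized1 f ∧ IsConvInvertible f

/-- The measuring 1-cocycle condition `f(ts)(n) = ∑ f(s₍₁₎)(n₍₁₎) f(t)(s₍₂₎(n₍₂₎))`. -/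
def MeasCocycle1 (μ : T ⊗[k] N →ₗ[k] N) (f : T ⊗[k] N →ₗ[k] A) : Prop :=
  f ∘ₗ LinearMap.rTensor N (LinearMap.mul' k T)
    = conv (f ∘ₗ LinearMap.rTensor N (dropL T T))
      (f ∘ₗ LinearMap.lTensor T μ ∘ₗ (TensorProduct.assoc k T T N).toLinearMap)

/-- Measuring 1-cocycles. -/
def IsMeasZ1 (μ : T ⊗[k] N →ₗ[k] N) (f : T ⊗[k] N →ₗ[k] A) : Prop :=
  IsRegMeas1 f ∧ MeasCocycle1 μ f

/-- Measuring 1-coboundaries: `f(t)(n) = ∑ g(n₍₁₎) g⁻¹(t(n₍₂₎))` for a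
convolution-invertible algebra map `g : N → A`. -/
def IsMeasB1 (μ : T ⊗[k] N →ₗ[k] N) (f : T ⊗[k] N →ₗ[k] A) : Prop :=
  ∃ (g : N →ₐ[k] A) (ginv : N →ₗ[k] A), IsConvInv g.toLinearMap ginv ∧
    f = conv (g.toLinearMap ∘ₗ dropL T N) (ginv ∘ₗ μ)

/-- Normalization for measuring 2-cochains `(T ⊗ T) ⊗ N → A`. -/
def MeasNormalized2 (f : (T ⊗[k] T) ⊗[k] N →ₗ[k] A) : Prop :=
  ∀ (t : T) (n : N),
    f (((1 : T) ⊗ₜ[k] t) ⊗ₜ[k] n)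
        = algebraMap k A (Coalgebra.counit t * Coalgebra.counit n)
    ∧ f ((t ⊗ₜ[k] (1 : T)) ⊗ₜ[k] n)
        = algebraMap k A (Coalgebra.counit t * Coalgebra.counit n)

/-- A measuring 2-cochain: an element of `Reg_meas(T ⊗ T, Hom(N,A))`. -/
def IsRegMeas2 (f : (T ⊗[k] T) ⊗[k] N →ₗ[k] A) : Prop :=
  Measures f ∧ MeasNormalized2 f ∧ IsConvInvertible f

/-- The measuring 2-cocycle condition
`∑ f(t₍₁₎⊗s₍₁₎)(r₍₁₎(n₍₁₎)) f(t₍₂₎s₍₂₎⊗r₍₂₎)(n₍₂₎) = ∑ f(s₍₁₎⊗r₍₁₎)(n₍₁₎) f(t⊗s₍₂₎r₍₂₎)(n₍₂₎)`. -/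
def MeasCocycle2 (μ : T ⊗[k] N →ₗ[k] N) (f : (T ⊗[k] T) ⊗[k] N →ₗ[k] A) : Prop :=
  conv (C := ((T ⊗[k] T) ⊗[k] T) ⊗[k] N)
       (f ∘ₗ (LinearMap.lTensor (T ⊗[k] T) μ
          ∘ₗ (TensorProduct.assoc k (T ⊗[k] T) T N).toLinearMap :
            ((T ⊗[k] T) ⊗[k] T) ⊗[k] N →ₗ[k] (T ⊗[k] T) ⊗[k] N))
       (f ∘ₗ LinearMap.rTensor N (LinearMap.rTensor T (LinearMap.mul' k T)))
    = conv (C := ((T ⊗[k] T) ⊗[k] T) ⊗[k] N)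
           (f ∘ₗ LinearMap.rTensor N (LinearMap.rTensor T (dropL T T)))
           (f ∘ₗ LinearMap.rTensor N
              ((LinearMap.lTensor T (LinearMap.mul' k T)
                ∘ₗ (TensorProduct.assoc k T T T).toLinearMap :
                  (T ⊗[k] T) ⊗[k] T →ₗ[k] T ⊗[k] T)))

/-- Measuring 2-cocycles. -/
def IsMeasZ2 (μ : T ⊗[k] N →ₗ[k] N) (f : (T ⊗[k] T) ⊗[k] N →ₗ[k] A) : Prop :=
  IsRegMeas2 f ∧ MeasCocycle2 μ f

/-- The measuring coboundary
`(t ⊗ s ⊗ n) ↦ ∑ g(s₍₁₎)(n₍₁₎) g⁻¹(t₍₁₎s₍₂₎)(n₍₂₎) g(t₍₂₎)(s₍₃₎(n₍₃₎))`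
of a 1-cochain `g` with convolution inverse `ginv`.  (For a 2-cocycle `f` on `N` with
stability witness `g`, this same formula is the map `d`. ) -/
noncomputable def measCobound (μ : T ⊗[k] N →ₗ[k] N) (g ginv : T ⊗[k] N →ₗ[k] A) :
    (T ⊗[k] T) ⊗[k] N →ₗ[k] A :=
  conv (g ∘ₗ LinearMap.rTensor N (dropL T T))
    (conv (ginv ∘ₗ LinearMap.rTensor N (LinearMap.mul' k T))
          (g ∘ₗ LinearMap.lTensor T μ ∘ₗ (TensorProduct.assoc k T T N).toLinearMap))

/-- Measuring 2-coboundaries. -/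
def IsMeasB2 (μ : T ⊗[k] N →ₗ[k] N) (f : (T ⊗[k] T) ⊗[k] N →ₗ[k] A) : Prop :=
  ∃ g ginv : T ⊗[k] N →ₗ[k] A, IsRegMeas1 g ∧ IsConvInv g ginv ∧ f = measCobound μ g ginv

/-- Cohomologous measuring 2-cochains. -/
def MeasCohomologous2 (μ : T ⊗[k] N →ₗ[k] N) (f f' : (T ⊗[k] T) ⊗[k] N →ₗ[k] A) : Prop :=
  ∃ b, IsMeasB2 μ b ∧ f = conv f' b

/-- `∑ f(n₍₁₎ ⊗ n'₍₁₎) f⁻¹(t₍₁₎(n₍₂₎) ⊗ t₍₂₎(n'₍₂₎))` as a map `T ⊗ (N ⊗ N) → A`. -/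
noncomputable def stabLHS (μ : T ⊗[k] N →ₗ[k] N) (f finv : N ⊗[k] N →ₗ[k] A) :
    T ⊗[k] (N ⊗[k] N) →ₗ[k] A :=
  conv (f ∘ₗ dropL T (N ⊗[k] N))
       (finv ∘ₗ TensorProduct.map μ μ
          ∘ₗ (TensorProduct.tensorTensorTensorComm k T T N N).toLinearMap
          ∘ₗ LinearMap.rTensor (N ⊗[k] N) Coalgebra.comul)

/-- `∑ g(t₍₁₎ ⊗ n₍₁₎) g⁻¹(t₍₂₎ ⊗ n₍₂₎n'₍₁₎) g(t₍₃₎ ⊗ n'₍₂₎)` as a map `T ⊗ (N ⊗ N) → A`. -/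
noncomputable def stabRHS (g ginv : T ⊗[k] N →ₗ[k] A) : T ⊗[k] (N ⊗[k] N) →ₗ[k] A :=
  conv (g ∘ₗ LinearMap.lTensor T (dropR N N))
    (conv (ginv ∘ₗ LinearMap.lTensor T (LinearMap.mul' k N))
          (g ∘ₗ LinearMap.lTensor T (dropL N N)))

/-- `g` (with convolution inverse `ginv`) witnesses the `T`-stability of the
2-cochain `f` on `N` (with convolution inverse `finv`):
`f * (f⁻¹)ᵗ = δ'(g(t ⊗ _))`. -/
def IsStabilityWitness (μ : T ⊗[k] N →ₗ[k] N) (f finv : N ⊗[k] N →ₗ[k] A)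
    (g ginv : T ⊗[k] N →ₗ[k] A) : Prop :=
  MeasNormalized1 g ∧ (∀ t : T, g (t ⊗ₜ[k] (1 : N)) = algebraMap k A (Coalgebra.counit t))
    ∧ IsConvInv g ginv ∧ stabLHS μ f finv = stabRHS g ginv

/-- The cohomology class of the 2-cocycle `f` on `N` is `T`-stable. -/
def IsTStable (μ : T ⊗[k] N →ₗ[k] N) (f finv : N ⊗[k] N →ₗ[k] A) : Prop :=
  ∃ g ginv, IsStabilityWitness μ f finv g ginv

end MeasCohomology

section SmashStatements

variable {k : Type} [Field k]
variable {T N H A : Type} [Ring T] [Bialgebra k T] [Ring N] [Bialgebra k N]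
  [Ring H] [Bialgebra k H] [CommRing A] [Algebra k A]

/-- `n ⊗ t ↦ (n ⋊ 1)(1 ⋊ t) = n ⋊ t`. -/
noncomputable def smashMul (iN : N →ₐc[k] H) (iT : T →ₐc[k] H) : N ⊗[k] T →ₗ[k] H :=
  LinearMap.mul' k H ∘ₗ TensorProduct.map iN.toLinearMap iT.toLinearMap

/-- The restriction of a 2-cochain on `H` to `N ⊗ N`. -/
noncomputable def resNN (iN : N →ₐc[k] H) (f : H ⊗[k] H →ₗ[k] A) : N ⊗[k] N →ₗ[k] A :=
  f ∘ₗ TensorProduct.map iN.toLinearMap iN.toLinearMap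

/-- The restriction of a 2-cochain on `H` to `T ⊗ T`. -/
noncomputable def resTT (iT : T →ₐc[k] H) (f : H ⊗[k] H →ₗ[k] A) : T ⊗[k] T →ₗ[k] A :=
  f ∘ₗ TensorProduct.map iT.toLinearMap iT.toLinearMap

/-- The restriction of a 2-cochain on `H` to `T ⊗ N`. -/
noncomputable def resTN (iN : N →ₐc[k] H) (iT : T →ₐc[k] H) (f : H ⊗[k] H →ₗ[k] A) :
    T ⊗[k] N →ₗ[k] A :=
  f ∘ₗ TensorProduct.map iT.toLinearMap iN.toLinearMap

/-- `f` is trivial on `N ⊗ T`: `f(n ⊗ t) = ε(n)ε(t)1`. -/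
def TrivialOnNT (iN : N →ₐc[k] H) (iT : T →ₐc[k] H) (f : H ⊗[k] H →ₗ[k] A) : Prop :=
  ∀ (n : N) (t : T), f (iN n ⊗ₜ[k] iT t)
    = algebraMap k A (Coalgebra.counit n * Coalgebra.counit t)

/-- `f` is trivial on `T ⊗ T`. -/
def TrivialOnTT (iT : T →ₐc[k] H) (f : H ⊗[k] H →ₗ[k] A) : Prop :=
  ∀ t t' : T, f (iT t ⊗ₜ[k] iT t')
    = algebraMap k A (Coalgebra.counit t * Coalgebra.counit t')

/-- `F` is the 2-cochain `ι f : (n ⋊ t) ⊗ (n' ⋊ t') ↦ ε(n) f(t)(n') ε(t')` on `H`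
associated with a measuring 1-cochain `f`. -/
def IotaOf (iN : N →ₐc[k] H) (iT : T →ₐc[k] H) (f : T ⊗[k] N →ₗ[k] A)
    (F : H ⊗[k] H →ₗ[k] A) : Prop :=
  ∀ (n : N) (t : T) (n' : N) (t' : T),
    F ((iN n * iT t) ⊗ₜ[k] (iN n' * iT t'))
      = algebraMap k A (Coalgebra.counit n * Coalgebra.counit t') * f (t ⊗ₜ[k] n')

/-- `J` is the 3-cochain
`jf : (n⋊t) ⊗ (n'⋊t') ⊗ (n''⋊t'') ↦ ε(n)ε(n') f(t⊗t')(n'') ε(t'')` on `H`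
associated with a measuring 2-cochain `f`. -/
def JOf (iN : N →ₐc[k] H) (iT : T →ₐc[k] H) (f : (T ⊗[k] T) ⊗[k] N →ₗ[k] A)
    (J : (H ⊗[k] H) ⊗[k] H →ₗ[k] A) : Prop :=
  ∀ (n : N) (t : T) (n' : N) (t' : T) (n'' : N) (t'' : T),
    J (((iN n * iT t) ⊗ₜ[k] (iN n' * iT t')) ⊗ₜ[k] (iN n'' * iT t''))
      = algebraMap k A (Coalgebra.counit n * Coalgebra.counit n' * Coalgebra.counit t'')
          * f ((t ⊗ₜ[k] t') ⊗ₜ[k] n'')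

end SmashStatements

end SmashPaper

open TensorProduct SmashPaper

/-- For a 2-cochain `f` on `H = N ⊗ T` (with convolution inverse `finv`), the map
`f̃(t ⊗ n) = ∑ f(t₍₁₎ ⊗ n₍₁₎) f⁻¹(n₍₂₎ ⊗ t₍₂₎)`. -/
noncomputable def tildeMap {k : Type} [Field k] {T N H A : Type}
    [Ring T] [Bialgebra k T] [Ring N] [Bialgebra k N]
    [Ring H] [Bialgebra k H] [CommRing A] [Algebra k A]
    (iN : N →ₐc[k] H) (iT : T →ₐc[k] H) (f finv : H ⊗[k] H →ₗ[k] A) :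
    T ⊗[k] N →ₗ[k] A :=
  conv (f ∘ₗ TensorProduct.map iT.toLinearMap iN.toLinearMap)
       (finv ∘ₗ TensorProduct.map iN.toLinearMap iT.toLinearMap
             ∘ₗ (TensorProduct.comm k T N).toLinearMap)

namespace SmashPaper

open WithConv

section Points

variable {k : Type} [Field k]
variable {C C' D D' E E' : Type}
  [AddCommGroup C] [Module k C] [AddCommGroup C'] [Module k C']
  [AddCommGroup D] [Module k D] [AddCommGroup D'] [Module k D']
  [AddCommGroup E] [Module k E] [AddCommGroup E'] [Module k E']

theorem dropR_tmul [Coalgebra k E] (c : C) (e : E) :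
    dropR C E (c ⊗ₜ[k] e) = Coalgebra.counit (R := k) e • c := by
  simp [dropR]

theorem dropL_tmul [Coalgebra k C] (c : C) (e : E) :
    dropL C E (c ⊗ₜ[k] e) = Coalgebra.counit (R := k) c • e := by
  simp [dropL]

variable [Coalgebra k C] [Coalgebra k C'] [Coalgebra k D] [Coalgebra k D'] [Coalgebra k E]
  [Coalgebra k E']

theorem IsCocomm.toIsCocomm (h : IsCocomm k C) : Coalgebra.IsCocomm k C := ⟨h⟩

theorem coalgHom_ext {x y : C →ₗc[k] D} (h : x.toLinearMap = y.toLinearMap) : x = y :=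
  CoalgHom.coe_linearMap_injective h

theorem dropR_comp_map (x : D →ₗc[k] C) (y : D' →ₗc[k] E) :
    dropR C E ∘ₗ TensorProduct.map x.toLinearMap y.toLinearMap = x.toLinearMap ∘ₗ dropR D D' := by
  apply TensorProduct.ext'
  intro c e
  simp [dropR_tmul]

theorem dropL_comp_map (x : D →ₗc[k] C) (y : D' →ₗc[k] E) :
    dropL C E ∘ₗ TensorProduct.map x.toLinearMap y.toLinearMap = y.toLinearMap ∘ₗ dropL D D' := by
  apply TensorProduct.ext'
  intro c e
  simp [dropL_tmul]

theorem dropR_comp_comul : dropR C C ∘ₗ Coalgebra.comul = LinearMap.id (R := k) := by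
  ext c
  simp [dropR]

theorem dropL_comp_comul : dropL C C ∘ₗ Coalgebra.comul = LinearMap.id (R := k) := by
  ext c
  simp [dropL]

variable [Coalgebra.IsCocomm k D] [Coalgebra.IsCocomm k D']

/-- The coalgebra map `d ↦ ∑ x(d₍₁₎) ⊗ y(d₍₂₎)` with components `x` and `y`. -/
noncomputable def pair (x : D →ₗc[k] C) (y : D →ₗc[k] E) : D →ₗc[k] C ⊗[k] E :=
  (Coalgebra.TensorProduct.map x y).comp (Coalgebra.comulCoalgHom k D)

theorem pair_toLinearMap (x : D →ₗc[k] C) (y : D →ₗc[k] E) :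
    (pair x y).toLinearMap
      = TensorProduct.map x.toLinearMap y.toLinearMap ∘ₗ Coalgebra.comul := rfl

theorem pair_comp (x : D →ₗc[k] C) (y : D →ₗc[k] E) (φ : D' →ₗc[k] D) :
    (pair x y).comp φ = pair (x.comp φ) (y.comp φ) := by
  apply coalgHom_ext
  change TensorProduct.map x.toLinearMap y.toLinearMap ∘ₗ Coalgebra.comul ∘ₗ φ.toLinearMap
    = TensorProduct.map (x.toLinearMap ∘ₗ φ.toLinearMap) (y.toLinearMap ∘ₗ φ.toLinearMap)
      ∘ₗ Coalgebra.comul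
  rw [TensorProduct.map_comp, LinearMap.comp_assoc, ← φ.map_comp_comul]

theorem map_comp_pair (f : C →ₗc[k] C') (g : E →ₗc[k] E') (x : D →ₗc[k] C) (y : D →ₗc[k] E) :
    (Coalgebra.TensorProduct.map f g : C ⊗[k] E →ₗc[k] C' ⊗[k] E').comp (pair x y)
      = pair (f.comp x) (g.comp y) := by
  apply coalgHom_ext
  change TensorProduct.map f.toLinearMap g.toLinearMap
      ∘ₗ TensorProduct.map x.toLinearMap y.toLinearMap ∘ₗ Coalgebra.comul
    = TensorProduct.map (f.toLinearMap ∘ₗ x.toLinearMap) (g.toLinearMap ∘ₗ y.toLinearMap)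
      ∘ₗ Coalgebra.comul
  rw [TensorProduct.map_comp, LinearMap.comp_assoc]

variable (k C E) in
/-- The projection `C ⊗ E → C`, whose underlying linear map is `dropR C E`. -/
noncomputable def fstHom : C ⊗[k] E →ₗc[k] C :=
  (Coalgebra.TensorProduct.rid k k C).toCoalgHom.comp
    (Coalgebra.TensorProduct.map (CoalgHom.id k C) (Coalgebra.counitCoalgHom k E))

variable (k C E) in
/-- The projection `C ⊗ E → E`, whose underlying linear map is `dropL C E`. -/
noncomputable def sndHom : C ⊗[k] E →ₗc[k] E :=
  (Coalgebra.TensorProduct.lid k E).toCoalgHom.comp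
    (Coalgebra.TensorProduct.map (Coalgebra.counitCoalgHom k C) (CoalgHom.id k E))

theorem fstHom_comp_pair (x : D →ₗc[k] C) (y : D →ₗc[k] E) :
    (fstHom k C E).comp (pair x y) = x := by
  apply coalgHom_ext
  change dropR C E ∘ₗ TensorProduct.map x.toLinearMap y.toLinearMap ∘ₗ Coalgebra.comul
    = x.toLinearMap
  rw [← LinearMap.comp_assoc, dropR_comp_map, LinearMap.comp_assoc, dropR_comp_comul,
    LinearMap.comp_id]

theorem sndHom_comp_pair (x : D →ₗc[k] C) (y : D →ₗc[k] E) :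
    (sndHom k C E).comp (pair x y) = y := by
  apply coalgHom_ext
  change dropL C E ∘ₗ TensorProduct.map x.toLinearMap y.toLinearMap ∘ₗ Coalgebra.comul
    = y.toLinearMap
  rw [← LinearMap.comp_assoc, dropL_comp_map, LinearMap.comp_assoc, dropL_comp_comul,
    LinearMap.comp_id]

theorem pair_fstHom_sndHom [Coalgebra.IsCocomm k C] [Coalgebra.IsCocomm k E] :
    pair (fstHom k C E) (sndHom k C E) = CoalgHom.id k (C ⊗[k] E) := by
  apply coalgHom_ext
  have h : TensorProduct.map (dropR C E) (dropL C E)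
        ∘ₗ (TensorProduct.tensorTensorTensorComm k C C E E).toLinearMap
      = TensorProduct.map (dropR C C) (dropL E E) := by
    ext c c' e e'
    simp [dropR_tmul, dropL_tmul, TensorProduct.smul_tmul', TensorProduct.tmul_smul, smul_smul,
      mul_comm]
  change TensorProduct.map (dropR C E) (dropL C E)
        ∘ₗ (TensorProduct.tensorTensorTensorComm k C C E E).toLinearMap
        ∘ₗ TensorProduct.map Coalgebra.comul Coalgebra.comul = LinearMap.id
  rw [← LinearMap.comp_assoc, h, ← TensorProduct.map_comp, dropR_comp_comul, dropL_comp_comul,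
    TensorProduct.map_id]

theorem pair_eta [Coalgebra.IsCocomm k C] [Coalgebra.IsCocomm k E] (φ : D →ₗc[k] C ⊗[k] E) :
    pair ((fstHom k C E).comp φ) ((sndHom k C E).comp φ) = φ := by
  rw [← pair_comp, pair_fstHom_sndHom, CoalgHom.id_comp]

theorem comm_comp_pair (x : D →ₗc[k] C) (y : D →ₗc[k] E) :
    (TensorProduct.comm k C E).toLinearMap ∘ₗ (pair x y).toLinearMap
      = (pair y x).toLinearMap := by
  rw [pair_toLinearMap, pair_toLinearMap, ← LinearMap.comp_assoc, ← TensorProduct.map_comp_comm_eq,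
    LinearMap.comp_assoc, Coalgebra.comm_comp_comul]

variable (k C C' E) in
/-- The associativity isomorphism as a coalgebra map. -/
noncomputable def assocHom : (C ⊗[k] C') ⊗[k] E →ₗc[k] C ⊗[k] (C' ⊗[k] E) :=
  (Coalgebra.TensorProduct.assoc k k C C' E).toCoalgHom

theorem assocHom_comp_pair (x : D →ₗc[k] C) (y : D →ₗc[k] C') (z : D →ₗc[k] E) :
    (assocHom k C C' E).comp (pair (pair x y) z) = pair x (pair y z) := by
  apply coalgHom_ext
  change (TensorProduct.assoc k C C' E).toLinearMap ∘ₗ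
      TensorProduct.map (TensorProduct.map x.toLinearMap y.toLinearMap ∘ₗ Coalgebra.comul)
        z.toLinearMap ∘ₗ Coalgebra.comul
    = TensorProduct.map x.toLinearMap
        (TensorProduct.map y.toLinearMap z.toLinearMap ∘ₗ Coalgebra.comul) ∘ₗ Coalgebra.comul
  have h1 : TensorProduct.map (TensorProduct.map x.toLinearMap y.toLinearMap ∘ₗ Coalgebra.comul)
        z.toLinearMap
      = TensorProduct.map (TensorProduct.map x.toLinearMap y.toLinearMap) z.toLinearMap
        ∘ₗ LinearMap.rTensor D Coalgebra.comul := by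
    rw [LinearMap.rTensor, ← TensorProduct.map_comp, LinearMap.comp_id]
  have h2 : TensorProduct.map x.toLinearMap
        (TensorProduct.map y.toLinearMap z.toLinearMap ∘ₗ Coalgebra.comul)
      = TensorProduct.map x.toLinearMap (TensorProduct.map y.toLinearMap z.toLinearMap)
        ∘ₗ LinearMap.lTensor D Coalgebra.comul := by
    rw [LinearMap.lTensor, ← TensorProduct.map_comp, LinearMap.comp_id]
  rw [h1, h2, LinearMap.comp_assoc, LinearMap.comp_assoc, ← Coalgebra.coassoc,
    ← LinearMap.comp_assoc, ← LinearMap.comp_assoc, ← LinearMap.comp_assoc,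
    TensorProduct.map_map_comp_assoc_eq]
  rfl

end Points

section PointProduct

variable {k : Type} [Field k]
variable {D : Type} [AddCommGroup D] [Module k D] [Coalgebra k D]
variable {H K : Type} [Ring H] [Bialgebra k H] [Ring K] [Bialgebra k K]

/-- The trivial coalgebra map `d ↦ ε(d) 1`. -/
noncomputable def pone (k D H : Type) [Field k] [AddCommGroup D] [Module k D] [Coalgebra k D]
    [Ring H] [Bialgebra k H] : D →ₗc[k] H :=
  (Bialgebra.unitBialgHom k H).toCoalgHom.comp (Coalgebra.counitCoalgHom k D)

theorem pone_toLinearMap : (pone k D H).toLinearMap = (1 : WithConv (D →ₗ[k] H)).ofConv := rfl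

theorem pone_apply (d : D) : pone k D H d = Coalgebra.counit (R := k) d • (1 : H) :=
  Algebra.algebraMap_eq_smul_one _

theorem comp_pone (i : H →ₐc[k] K) : i.toCoalgHom.comp (pone k D H) = pone k D K := by
  apply coalgHom_ext
  ext d
  change i (algebraMap k H (Coalgebra.counit d)) = algebraMap k K (Coalgebra.counit d)
  exact (i : H →ₐ[k] K).commutes _

variable [Coalgebra.IsCocomm k D]

/-- The convolution product `d ↦ ∑ x(d₍₁₎) y(d₍₂₎)` of coalgebra maps into a bialgebra. -/
noncomputable def pmul (x y : D →ₗc[k] H) : D →ₗc[k] H :=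
  (Bialgebra.mulCoalgHom k H).comp (pair x y)

local notation:70 x:70 "⊙" y:71 => pmul x y

theorem pmul_toLinearMap (x y : D →ₗc[k] H) :
    (x ⊙ y).toLinearMap = (toConv x.toLinearMap * toConv y.toLinearMap).ofConv := rfl

theorem pmul_assoc (x y z : D →ₗc[k] H) : x ⊙ y ⊙ z = x ⊙ (y ⊙ z) := by
  apply coalgHom_ext
  simp only [pmul_toLinearMap, toConv_ofConv, mul_assoc]

@[simp] theorem pone_pmul (x : D →ₗc[k] H) : pone k D H ⊙ x = x := by
  apply coalgHom_ext
  simp only [pmul_toLinearMap, pone_toLinearMap, toConv_ofConv, one_mul]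

@[simp] theorem pmul_pone (x : D →ₗc[k] H) : x ⊙ pone k D H = x := by
  apply coalgHom_ext
  simp only [pmul_toLinearMap, pone_toLinearMap, toConv_ofConv, mul_one]

theorem comp_pmul (i : H →ₐc[k] K) (x y : D →ₗc[k] H) :
    i.toCoalgHom.comp (x ⊙ y) = i.toCoalgHom.comp x ⊙ i.toCoalgHom.comp y := by
  rw [pmul, pmul, ← map_comp_pair, ← CoalgHom.comp_assoc, ← CoalgHom.comp_assoc]
  congr 1
  apply coalgHom_ext
  apply TensorProduct.ext'
  intro a b
  exact map_mul i a b

variable {C : Type} [AddCommGroup C] [Module k C] [Coalgebra k C]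

theorem pair_pone_left (x : D →ₗc[k] C) :
    (pair (pone k D H) x).toLinearMap = TensorProduct.mk k H C 1 ∘ₗ x.toLinearMap := by
  have h : TensorProduct.map (pone k D H).toLinearMap x.toLinearMap
      = TensorProduct.mk k H C 1 ∘ₗ x.toLinearMap ∘ₗ dropL D D := by
    apply TensorProduct.ext'
    intro d e
    simp [dropL_tmul, pone_apply, TensorProduct.smul_tmul']
  rw [pair_toLinearMap, h, LinearMap.comp_assoc, LinearMap.comp_assoc, dropL_comp_comul,
    LinearMap.comp_id]

theorem pair_pone_right (x : D →ₗc[k] C) :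
    (pair x (pone k D H)).toLinearMap
      = (TensorProduct.mk k C H).flip 1 ∘ₗ x.toLinearMap := by
  rw [← comm_comp_pair, pair_pone_left]
  rfl

end PointProduct

section Reg

variable {k : Type} [Field k]
variable {C C' D A : Type}
  [AddCommGroup C] [Module k C] [Coalgebra k C] [AddCommGroup C'] [Module k C'] [Coalgebra k C']
  [AddCommGroup D] [Module k D] [Coalgebra k D] [CommRing A] [Algebra k A]

/-- The convolution-invertible linear maps `C → A`, written additively. -/
def Reg (k C A : Type) [Field k] [AddCommGroup C] [Module k C] [Coalgebra k C] [CommRing A]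
    [Algebra k A] : Type :=
  Additive (WithConv (C →ₗ[k] A))ˣ

/-- The linear map underlying an element of `Reg`. -/
def Reg.toLin (F : Reg k C A) : C →ₗ[k] A :=
  (Additive.toMul F : (WithConv (C →ₗ[k] A))ˣ).val.ofConv

theorem Reg.toLin_injective : Function.Injective (Reg.toLin : Reg k C A → C →ₗ[k] A) := by
  intro F G h
  apply Additive.toMul.injective
  apply Units.ext
  exact WithConv.ofConv_injective h

variable [Coalgebra.IsCocomm k C] [Coalgebra.IsCocomm k C'] [Coalgebra.IsCocomm k D]

noncomputable instance : AddCommGroup (Reg k C A) :=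
  inferInstanceAs (AddCommGroup (Additive (WithConv (C →ₗ[k] A))ˣ))

theorem Reg.toLin_add (F G : Reg k C A) : (F + G).toLin = conv F.toLin G.toLin := rfl

theorem Reg.toLin_zero : (0 : Reg k C A).toLin = convOne C A := rfl

theorem Reg.isConvInv (F : Reg k C A) : IsConvInv F.toLin (-F).toLin := by
  rw [IsConvInv, ← toLin_add, ← toLin_add, add_neg_cancel, neg_add_cancel, toLin_zero]
  exact ⟨rfl, rfl⟩

theorem IsConvInv.exists_reg {f g : C →ₗ[k] A} (h : IsConvInv f g) :
    ∃ F : Reg k C A, F.toLin = f ∧ (-F).toLin = g :=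
  ⟨Additive.ofMul ⟨toConv f, toConv g, congrArg toConv h.1, congrArg toConv h.2⟩, rfl, rfl⟩

theorem isConvInvertible_iff {f : C →ₗ[k] A} :
    IsConvInvertible f ↔ ∃ F : Reg k C A, F.toLin = f := by
  constructor
  · rintro ⟨g, h⟩
    obtain ⟨F, hF, -⟩ := h.exists_reg
    exact ⟨F, hF⟩
  · rintro ⟨F, rfl⟩
    exact ⟨_, F.isConvInv⟩

/-- Restriction along a coalgebra map. -/
noncomputable def Reg.pull (φ : D →ₗc[k] C) : Reg k C A →+ Reg k D A :=
  MonoidHom.toAdditive (Units.map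
    { toFun := fun f => toConv (f.ofConv ∘ₗ φ.toLinearMap)
      map_one' := by
        apply WithConv.ofConv_injective
        change Algebra.linearMap k A ∘ₗ Coalgebra.counit ∘ₗ φ.toLinearMap
          = Algebra.linearMap k A ∘ₗ Coalgebra.counit
        rw [φ.counit_comp]
      map_mul' := fun f g => by
        apply WithConv.ofConv_injective
        exact LinearMap.convMul_comp_coalgHom_distrib f g φ })

theorem Reg.toLin_pull (φ : D →ₗc[k] C) (F : Reg k C A) :
    (Reg.pull φ F).toLin = F.toLin ∘ₗ φ.toLinearMap := rfl

theorem Reg.pull_pull {E : Type} [AddCommGroup E] [Module k E] [Coalgebra k E]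
    [Coalgebra.IsCocomm k E] (φ : D →ₗc[k] C) (ψ : E →ₗc[k] D) (F : Reg k C A) :
    Reg.pull ψ (Reg.pull φ F) = Reg.pull (φ.comp ψ) F := rfl

theorem Reg.ext_pull {F G : Reg k C A}
    (h : ∀ (D : Type) [AddCommGroup D] [Module k D] [Coalgebra k D] [Coalgebra.IsCocomm k D]
      (x : D →ₗc[k] C), Reg.pull x F = Reg.pull x G) : F = G :=
  h C (CoalgHom.id k C)

/-- The value of a 2-cochain at a pair of coalgebra maps. -/
noncomputable def Reg.ev (F : Reg k (C ⊗[k] C') A) (x : D →ₗc[k] C) (y : D →ₗc[k] C') :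
    Reg k D A :=
  Reg.pull (pair x y) F

theorem Reg.ext_ev {F G : Reg k (C ⊗[k] C') A}
    (h : ∀ (D : Type) [AddCommGroup D] [Module k D] [Coalgebra k D] [Coalgebra.IsCocomm k D]
      (x : D →ₗc[k] C) (y : D →ₗc[k] C'), F.ev x y = G.ev x y) : F = G := by
  apply ext_pull
  intro D _ _ _ _ x
  rw [← pair_eta x]
  exact h D _ _

end Reg

section Evaluation

variable {k : Type} [Field k]
variable {C C' D D' E E' A : Type}
  [AddCommGroup C] [Module k C] [Coalgebra k C] [Coalgebra.IsCocomm k C]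
  [AddCommGroup C'] [Module k C'] [Coalgebra k C'] [Coalgebra.IsCocomm k C']
  [AddCommGroup D] [Module k D] [Coalgebra k D] [Coalgebra.IsCocomm k D]
  [AddCommGroup D'] [Module k D'] [Coalgebra k D'] [Coalgebra.IsCocomm k D']
  [AddCommGroup E] [Module k E] [Coalgebra k E] [Coalgebra.IsCocomm k E]
  [AddCommGroup E'] [Module k E'] [Coalgebra k E'] [Coalgebra.IsCocomm k E']
  [CommRing A] [Algebra k A]
variable {H : Type} [Ring H] [Bialgebra k H] [Coalgebra.IsCocomm k H]

local notation:70 x:70 "⊙" y:71 => pmul x y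

namespace Reg

theorem add_ev (F G : Reg k (C ⊗[k] E) A) (x : D →ₗc[k] C) (y : D →ₗc[k] E) :
    (F + G).ev x y = F.ev x y + G.ev x y :=
  map_add _ _ _

theorem sub_ev (F G : Reg k (C ⊗[k] E) A) (x : D →ₗc[k] C) (y : D →ₗc[k] E) :
    (F - G).ev x y = F.ev x y - G.ev x y :=
  map_sub _ _ _

theorem neg_ev (F : Reg k (C ⊗[k] E) A) (x : D →ₗc[k] C) (y : D →ₗc[k] E) :
    (-F).ev x y = -F.ev x y :=
  map_neg _ _

theorem pull_ev (φ : D' →ₗc[k] D) (F : Reg k (C ⊗[k] E) A) (x : D →ₗc[k] C) (y : D →ₗc[k] E) :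
    pull φ (F.ev x y) = F.ev (x.comp φ) (y.comp φ) := by
  rw [ev, pull_pull, pair_comp, ev]

theorem ev_pull_map (f : C →ₗc[k] C') (g : E →ₗc[k] E') (F : Reg k (C' ⊗[k] E') A)
    (x : D →ₗc[k] C) (y : D →ₗc[k] E) :
    (pull (Coalgebra.TensorProduct.map f g) F).ev x y = F.ev (f.comp x) (g.comp y) := by
  rw [ev, pull_pull, map_comp_pair, ev]

theorem ev_pull_fstHom (t : Reg k C A) (x : D →ₗc[k] C) (y : D →ₗc[k] E) :
    (pull (fstHom k C E) t).ev x y = pull x t := by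
  rw [ev, pull_pull, fstHom_comp_pair]

theorem ev_pull_sndHom (t : Reg k E A) (x : D →ₗc[k] C) (y : D →ₗc[k] E) :
    (pull (sndHom k C E) t).ev x y = pull y t := by
  rw [ev, pull_pull, sndHom_comp_pair]

theorem ev_pull_mulCoalgHom (t : Reg k H A) (x y : D →ₗc[k] H) :
    (pull (Bialgebra.mulCoalgHom k H) t).ev x y = pull (x ⊙ y) t := by
  rw [ev, pull_pull, pmul]

end Reg

theorem forall_one_tmul_iff (F : Reg k (H ⊗[k] C) A) :
    (∀ c : C, F.toLin (1 ⊗ₜ[k] c) = algebraMap k A (Coalgebra.counit c)) ↔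
      ∀ (D : Type) [AddCommGroup D] [Module k D] [Coalgebra k D] [Coalgebra.IsCocomm k D]
        (x : D →ₗc[k] C), F.ev (pone k D H) x = 0 := by
  constructor
  · intro h D _ _ _ _ x
    apply Reg.toLin_injective
    rw [Reg.ev, Reg.toLin_pull, pair_pone_left]
    ext d
    exact (h (x d)).trans (congrArg _ (CoalgHomClass.counit_comp_apply x d))
  · intro h c
    have := congrArg Reg.toLin (h C (CoalgHom.id k C))
    rw [Reg.ev, Reg.toLin_pull, pair_pone_left] at this
    exact LinearMap.congr_fun this c

theorem forall_tmul_one_iff (F : Reg k (C ⊗[k] H) A) :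
    (∀ c : C, F.toLin (c ⊗ₜ[k] 1) = algebraMap k A (Coalgebra.counit c)) ↔
      ∀ (D : Type) [AddCommGroup D] [Module k D] [Coalgebra k D] [Coalgebra.IsCocomm k D]
        (x : D →ₗc[k] C), F.ev x (pone k D H) = 0 := by
  constructor
  · intro h D _ _ _ _ x
    apply Reg.toLin_injective
    rw [Reg.ev, Reg.toLin_pull, pair_pone_right]
    ext d
    exact (h (x d)).trans (congrArg _ (CoalgHomClass.counit_comp_apply x d))
  · intro h c
    have := congrArg Reg.toLin (h C (CoalgHom.id k C))
    rw [Reg.ev, Reg.toLin_pull, pair_pone_right] at this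
    exact LinearMap.congr_fun this c

theorem normalized1_iff (t : Reg k H A) :
    Normalized1 t.toLin ↔
      ∀ (D : Type) [AddCommGroup D] [Module k D] [Coalgebra k D] [Coalgebra.IsCocomm k D],
        Reg.pull (pone k D H) t = 0 := by
  constructor
  · intro h D _ _ _ _
    apply Reg.toLin_injective
    ext d
    change t.toLin (algebraMap k H (Coalgebra.counit d)) = algebraMap k A (Coalgebra.counit d)
    rw [Algebra.algebraMap_eq_smul_one, Algebra.algebraMap_eq_smul_one, map_smul, h]
  · intro h
    have := LinearMap.congr_fun (congrArg Reg.toLin (h k)) 1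
    change t.toLin (algebraMap k H 1) = algebraMap k A 1 at this
    exact (congrArg t.toLin (map_one (algebraMap k H))).symm.trans (this.trans (map_one _))

end Evaluation

section Translation

variable {k : Type} [Field k]
variable {C A : Type} [AddCommGroup C] [Module k C] [Coalgebra k C] [Coalgebra.IsCocomm k C]
  [CommRing A] [Algebra k A]
variable {H T N : Type} [Ring H] [Bialgebra k H] [Coalgebra.IsCocomm k H]
  [Ring T] [Bialgebra k T]
    [Coalgebra.IsCocomm k T] [Ring N] [Bialgebra k N] [Coalgebra.IsCocomm k N]

local notation:70 x:70 "⊙" y:71 => pmul x y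

/-- A normalized 2-cocycle, described by its values at coalgebra maps. -/
structure IsCocycle (F : Reg k (H ⊗[k] H) A) : Prop where
  one_left : ∀ {D : Type} [AddCommGroup D] [Module k D] [Coalgebra k D] [Coalgebra.IsCocomm k D]
    (x : D →ₗc[k] H), F.ev (pone k D H) x = 0
  one_right : ∀ {D : Type} [AddCommGroup D] [Module k D] [Coalgebra k D] [Coalgebra.IsCocomm k D]
    (x : D →ₗc[k] H), F.ev x (pone k D H) = 0
  cocycle : ∀ {D : Type} [AddCommGroup D] [Module k D] [Coalgebra k D] [Coalgebra.IsCocomm k D]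
    (x y z : D →ₗc[k] H), F.ev x y + F.ev (x ⊙ y) z = F.ev y z + F.ev x (y ⊙ z)

/-- A bimultiplicative map on `T ⊗ N`, described by its values at coalgebra maps. -/
structure IsBimultiplicative (P : Reg k (T ⊗[k] N) A) : Prop where
  one_left : ∀ {D : Type} [AddCommGroup D] [Module k D] [Coalgebra k D] [Coalgebra.IsCocomm k D]
    (n : D →ₗc[k] N), P.ev (pone k D T) n = 0
  one_right : ∀ {D : Type} [AddCommGroup D] [Module k D] [Coalgebra k D] [Coalgebra.IsCocomm k D]
    (t : D →ₗc[k] T), P.ev t (pone k D N) = 0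
  mul_left : ∀ {D : Type} [AddCommGroup D] [Module k D] [Coalgebra k D] [Coalgebra.IsCocomm k D]
    (t s : D →ₗc[k] T) (n : D →ₗc[k] N), P.ev (t ⊙ s) n = P.ev s n + P.ev t n
  mul_right : ∀ {D : Type} [AddCommGroup D] [Module k D] [Coalgebra k D] [Coalgebra.IsCocomm k D]
    (t : D →ₗc[k] T) (n n' : D →ₗc[k] N), P.ev t (n ⊙ n') = P.ev t n + P.ev t n'

theorem cocycle2_iff (F : Reg k (H ⊗[k] H) A) :
    cocycle2LHS F.toLin = cocycle2RHS F.toLin ↔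
      ∀ (D : Type) [AddCommGroup D] [Module k D] [Coalgebra k D] [Coalgebra.IsCocomm k D]
        (x y z : D →ₗc[k] H), F.ev x y + F.ev (x ⊙ y) z = F.ev y z + F.ev x (y ⊙ z) := by
  let m := Bialgebra.mulCoalgHom k H
  let L : Reg k ((H ⊗[k] H) ⊗[k] H) A := Reg.pull (fstHom k (H ⊗[k] H) H) F
    + Reg.pull (Coalgebra.TensorProduct.map m (CoalgHom.id k H)) F
  let R : Reg k ((H ⊗[k] H) ⊗[k] H) A :=
    Reg.pull ((sndHom k H (H ⊗[k] H)).comp (assocHom k H H H)) F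
      + Reg.pull ((Coalgebra.TensorProduct.map (CoalgHom.id k H) m).comp (assocHom k H H H)) F
  have hL (D : Type) [AddCommGroup D] [Module k D] [Coalgebra k D] [Coalgebra.IsCocomm k D]
      (x y z : D →ₗc[k] H) : L.ev (pair x y) z = F.ev x y + F.ev (x ⊙ y) z := by
    rw [Reg.add_ev, Reg.ev_pull_fstHom, Reg.ev_pull_map, CoalgHom.id_comp]
    rfl
  have hR (D : Type) [AddCommGroup D] [Module k D] [Coalgebra k D] [Coalgebra.IsCocomm k D]
      (x y z : D →ₗc[k] H) : R.ev (pair x y) z = F.ev y z + F.ev x (y ⊙ z) := by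
    rw [Reg.add_ev, Reg.ev, Reg.ev, Reg.pull_pull, Reg.pull_pull, CoalgHom.comp_assoc,
      CoalgHom.comp_assoc, assocHom_comp_pair, sndHom_comp_pair, map_comp_pair, CoalgHom.id_comp]
    rfl
  have hLR : cocycle2LHS F.toLin = cocycle2RHS F.toLin ↔ L = R :=
    Reg.toLin_injective.eq_iff (a := L) (b := R)
  rw [hLR]
  constructor
  · intro h D _ _ _ _ x y z
    rw [← hL, ← hR, h]
  · intro h
    apply Reg.ext_ev
    intro D _ _ _ _ w z
    rw [← pair_eta w, hL, hR]
    exact h D _ _ _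

theorem isZ2_iff (F : Reg k (H ⊗[k] H) A) : IsZ2 F.toLin ↔ IsCocycle F := by
  rw [IsZ2, cocycle2_iff, Normalized2, forall_and, forall_one_tmul_iff, forall_tmul_one_iff]
  exact ⟨fun h => ⟨h.1.1 _, h.1.2 _, h.2.2 _⟩,
    fun h => ⟨⟨fun _ => h.one_left, fun _ => h.one_right⟩,
      isConvInvertible_iff.2 ⟨F, rfl⟩, fun _ => h.cocycle⟩⟩

theorem cohomologous2_iff (F F' : Reg k (H ⊗[k] H) A) :
    Cohomologous2 F.toLin F'.toLin ↔ ∃ t : Reg k H A,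
      (∀ (D : Type) [AddCommGroup D] [Module k D] [Coalgebra k D] [Coalgebra.IsCocomm k D],
        Reg.pull (pone k D H) t = 0) ∧
      ∀ (D : Type) [AddCommGroup D] [Module k D] [Coalgebra k D] [Coalgebra.IsCocomm k D]
        (x y : D →ₗc[k] H), F.ev x y
          = F'.ev x y + (Reg.pull y t + (-Reg.pull (x ⊙ y) t + Reg.pull x t)) := by
  let B (t : Reg k H A) : Reg k (H ⊗[k] H) A := Reg.pull (sndHom k H H) t
    + (Reg.pull (Bialgebra.mulCoalgHom k H) (-t) + Reg.pull (fstHom k H H) t)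
  have hFB (t : Reg k H A) : F = F' + B t ↔
      ∀ (D : Type) [AddCommGroup D] [Module k D] [Coalgebra k D] [Coalgebra.IsCocomm k D]
        (x y : D →ₗc[k] H), F.ev x y
          = F'.ev x y + (Reg.pull y t + (-Reg.pull (x ⊙ y) t + Reg.pull x t)) := by
    have hev (D : Type) [AddCommGroup D] [Module k D] [Coalgebra k D] [Coalgebra.IsCocomm k D]
        (x y : D →ₗc[k] H) : (F' + B t).ev x y
          = F'.ev x y + (Reg.pull y t + (-Reg.pull (x ⊙ y) t + Reg.pull x t)) := by
      simp only [B, Reg.add_ev, Reg.ev_pull_fstHom, Reg.ev_pull_sndHom, Reg.ev_pull_mulCoalgHom,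
        map_neg, Reg.neg_ev]
    constructor
    · intro h D _ _ _ _ x y
      rw [← hev, ← h]
    · intro h
      apply Reg.ext_ev
      intro D _ _ _ _ x y
      rw [hev, h]
  constructor
  · rintro ⟨b, ⟨t, tinv, ht, hinv, rfl⟩, hF⟩
    obtain ⟨t, rfl, rfl⟩ := hinv.exists_reg
    exact ⟨t, (normalized1_iff t).1 ht, (hFB t).1 (Reg.toLin_injective hF)⟩
  · rintro ⟨t, ht, h⟩
    exact ⟨_, ⟨t.toLin, (-t).toLin, (normalized1_iff t).2 ht, t.isConvInv, rfl⟩,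
      congrArg Reg.toLin ((hFB t).2 h)⟩

theorem measures_iff (P : Reg k (C ⊗[k] N) A) :
    Measures P.toLin ↔
      (∀ (D : Type) [AddCommGroup D] [Module k D] [Coalgebra k D] [Coalgebra.IsCocomm k D]
        (c : D →ₗc[k] C) (n n' : D →ₗc[k] N), P.ev c (n ⊙ n') = P.ev c n + P.ev c n') ∧
      ∀ (D : Type) [AddCommGroup D] [Module k D] [Coalgebra k D] [Coalgebra.IsCocomm k D]
        (c : D →ₗc[k] C), P.ev c (pone k D N) = 0 := by
  let i := CoalgHom.id k C
  let L : Reg k (C ⊗[k] (N ⊗[k] N)) A :=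
    Reg.pull (Coalgebra.TensorProduct.map i (Bialgebra.mulCoalgHom k N)) P
  let R : Reg k (C ⊗[k] (N ⊗[k] N)) A :=
    Reg.pull (Coalgebra.TensorProduct.map i (fstHom k N N)) P
      + Reg.pull (Coalgebra.TensorProduct.map i (sndHom k N N)) P
  have hL (D : Type) [AddCommGroup D] [Module k D] [Coalgebra k D] [Coalgebra.IsCocomm k D]
      (c : D →ₗc[k] C) (n n' : D →ₗc[k] N) : L.ev c (pair n n') = P.ev c (n ⊙ n') := by
    rw [Reg.ev_pull_map]
    rfl
  have hR (D : Type) [AddCommGroup D] [Module k D] [Coalgebra k D] [Coalgebra.IsCocomm k D]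
      (c : D →ₗc[k] C) (n n' : D →ₗc[k] N) :
      R.ev c (pair n n') = P.ev c n + P.ev c n' := by
    rw [Reg.add_ev, Reg.ev_pull_map, Reg.ev_pull_map, fstHom_comp_pair, sndHom_comp_pair,
      CoalgHom.id_comp]
  rw [Measures, forall_tmul_one_iff]
  refine and_congr_left' ((Reg.toLin_injective.eq_iff (a := L) (b := R)).trans ⟨?_, ?_⟩)
  · intro h D _ _ _ _ c n n'
    rw [← hL, ← hR, h]
  · intro h
    apply Reg.ext_ev
    intro D _ _ _ _ c w
    rw [← pair_eta w, hL, hR]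
    exact h D _ _ _

theorem measCocycle1_iff (P : Reg k (T ⊗[k] N) A) :
    MeasCocycle1 (dropL T N) P.toLin ↔
      ∀ (D : Type) [AddCommGroup D] [Module k D] [Coalgebra k D] [Coalgebra.IsCocomm k D]
        (t s : D →ₗc[k] T) (n : D →ₗc[k] N), P.ev (t ⊙ s) n = P.ev s n + P.ev t n := by
  let i := CoalgHom.id k N
  let L : Reg k ((T ⊗[k] T) ⊗[k] N) A :=
    Reg.pull (Coalgebra.TensorProduct.map (Bialgebra.mulCoalgHom k T) i) P
  let R : Reg k ((T ⊗[k] T) ⊗[k] N) A :=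
    Reg.pull (Coalgebra.TensorProduct.map (sndHom k T T) i) P
      + Reg.pull ((Coalgebra.TensorProduct.map (CoalgHom.id k T) (sndHom k T N)).comp
          (assocHom k T T N)) P
  have hL (D : Type) [AddCommGroup D] [Module k D] [Coalgebra k D] [Coalgebra.IsCocomm k D]
      (t s : D →ₗc[k] T) (n : D →ₗc[k] N) : L.ev (pair t s) n = P.ev (t ⊙ s) n := by
    rw [Reg.ev_pull_map]
    rfl
  have hR (D : Type) [AddCommGroup D] [Module k D] [Coalgebra k D] [Coalgebra.IsCocomm k D]
      (t s : D →ₗc[k] T) (n : D →ₗc[k] N) :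
      R.ev (pair t s) n = P.ev s n + P.ev t n := by
    rw [Reg.add_ev, Reg.ev_pull_map, Reg.ev, Reg.ev, Reg.pull_pull, CoalgHom.comp_assoc,
      assocHom_comp_pair, map_comp_pair, sndHom_comp_pair, sndHom_comp_pair, CoalgHom.id_comp,
      CoalgHom.id_comp]
    rfl
  refine (Reg.toLin_injective.eq_iff (a := L) (b := R)).trans ⟨?_, ?_⟩
  · intro h D _ _ _ _ t s n
    rw [← hL, ← hR, h]
  · intro h
    apply Reg.ext_ev
    intro D _ _ _ _ w n
    rw [← pair_eta w, hL, hR]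
    exact h D _ _ _

theorem isMeasZ1_iff (P : Reg k (T ⊗[k] N) A) :
    IsMeasZ1 (dropL T N) P.toLin ↔ IsBimultiplicative P := by
  rw [IsMeasZ1, IsRegMeas1, measCocycle1_iff, measures_iff, MeasNormalized1, forall_one_tmul_iff]
  exact ⟨fun h => ⟨h.1.2.1 _, h.1.1.2 _, h.2 _, h.1.1.1 _⟩,
    fun h => ⟨⟨⟨fun _ => h.mul_right, fun _ => h.one_right⟩, fun _ => h.one_left,
      isConvInvertible_iff.2 ⟨P, rfl⟩⟩, fun _ => h.mul_left⟩⟩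

theorem isMeasB1_dropL_iff (b : T ⊗[k] N →ₗ[k] A) :
    IsMeasB1 (dropL T N) b ↔ b = convOne (T ⊗[k] N) A := by
  constructor
  · rintro ⟨g, ginv, h, rfl⟩
    obtain ⟨G, hG, rfl⟩ := h.exists_reg
    rw [← hG]
    change (Reg.pull (sndHom k T N) G + Reg.pull (sndHom k T N) (-G)).toLin = _
    rw [map_neg, add_neg_cancel, Reg.toLin_zero]
  · rintro rfl
    refine ⟨(Algebra.ofId k A).comp (Bialgebra.counitAlgHom k N), convOne N A,
      (0 : Reg k N A).isConvInv, ?_⟩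
    change _ = (Reg.pull (sndHom k T N) 0 + Reg.pull (sndHom k T N) 0).toLin
    rw [map_zero, add_zero, Reg.toLin_zero]

theorem exists_isMeasB1_iff (P P' : Reg k (T ⊗[k] N) A) :
    (∃ b, IsMeasB1 (dropL T N) b ∧ P.toLin = conv P'.toLin b) ↔ P = P' := by
  simp only [isMeasB1_dropL_iff, exists_eq_left]
  rw [← Reg.toLin_zero, ← Reg.toLin_add, add_zero, Reg.toLin_injective.eq_iff]

end Translation

section Smash

variable {k : Type} [Field k]
variable {H T N : Type} [Ring H] [Bialgebra k H] [Ring T] [Bialgebra k T] [Ring N] [Bialgebra k N]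

local notation:70 x:70 "⊙" y:71 => pmul x y

/-- The coalgebra map `n ⊗ t ↦ iN n * iT t`. -/
noncomputable def smashHom (iN : N →ₐc[k] H) (iT : T →ₐc[k] H) : N ⊗[k] T →ₗc[k] H :=
  (Bialgebra.mulCoalgHom k H).comp (Coalgebra.TensorProduct.map iN.toCoalgHom iT.toCoalgHom)

theorem smashHom_comp_pair {D : Type} [AddCommGroup D] [Module k D] [Coalgebra k D]
    [Coalgebra.IsCocomm k D] (iN : N →ₐc[k] H) (iT : T →ₐc[k] H)
    (n : D →ₗc[k] N) (t : D →ₗc[k] T) :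
    (smashHom iN iT).comp (pair n t) = iN.toCoalgHom.comp n ⊙ iT.toCoalgHom.comp t := by
  rw [smashHom, CoalgHom.comp_assoc, map_comp_pair, pmul]

theorem isCocomm_of_surjective {C D : Type} [AddCommGroup C] [Module k C] [Coalgebra k C]
    [Coalgebra.IsCocomm k C] [AddCommGroup D] [Module k D] [Coalgebra k D]
    (φ : C →ₗc[k] D) (hφ : Function.Surjective φ) : Coalgebra.IsCocomm k D := by
  refine ⟨(LinearMap.cancel_right (g := φ.toLinearMap) hφ).1 ?_⟩
  rw [LinearMap.comp_assoc, ← φ.map_comp_comul, ← LinearMap.comp_assoc,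
    ← TensorProduct.map_comp_comm_eq, LinearMap.comp_assoc, Coalgebra.comm_comp_comul]

theorem smashCross_dropL :
    smashCross (dropL (k := k) T N) = (TensorProduct.comm k T N).toLinearMap := by
  have h : TensorProduct.map (dropL T N) (LinearMap.id (R := k) (M := T))
      ∘ₗ (TensorProduct.assoc k T N T).symm.toLinearMap
      ∘ₗ LinearMap.lTensor T (TensorProduct.comm k T N).toLinearMap
      ∘ₗ (TensorProduct.assoc k T T N).toLinearMap
      = (TensorProduct.comm k T N).toLinearMap ∘ₗ LinearMap.rTensor N (dropL T T) := by
    ext t s n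
    simp [dropL_tmul, TensorProduct.smul_tmul', TensorProduct.tmul_smul]
  calc smashCross (dropL (k := k) T N)
      = ((TensorProduct.comm k T N).toLinearMap ∘ₗ LinearMap.rTensor N (dropL T T))
          ∘ₗ LinearMap.rTensor N Coalgebra.comul := by rw [← h]; rfl
    _ = (TensorProduct.comm k T N).toLinearMap := by
      rw [LinearMap.comp_assoc, ← LinearMap.rTensor_comp, dropL_comp_comul, LinearMap.rTensor_id,
        LinearMap.comp_id]

/-- Coalgebra projections of `H` onto commuting tensor factors `N` and `T`. -/
structure Splitting (iN : N →ₐc[k] H) (iT : T →ₐc[k] H) where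
  projN : H →ₗc[k] N
  projT : H →ₗc[k] T
  projN_comp : ∀ {D : Type} [AddCommGroup D] [Module k D] [Coalgebra k D] [Coalgebra.IsCocomm k D]
    (n : D →ₗc[k] N) (t : D →ₗc[k] T),
    projN.comp (iN.toCoalgHom.comp n ⊙ iT.toCoalgHom.comp t) = n
  projT_comp : ∀ {D : Type} [AddCommGroup D] [Module k D] [Coalgebra k D] [Coalgebra.IsCocomm k D]
    (n : D →ₗc[k] N) (t : D →ₗc[k] T),
    projT.comp (iN.toCoalgHom.comp n ⊙ iT.toCoalgHom.comp t) = t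
  exists_eq : ∀ {D : Type} [AddCommGroup D] [Module k D] [Coalgebra k D] [Coalgebra.IsCocomm k D]
    (x : D →ₗc[k] H), ∃ (n : D →ₗc[k] N) (t : D →ₗc[k] T),
      x = iN.toCoalgHom.comp n ⊙ iT.toCoalgHom.comp t
  commute : ∀ {D : Type} [AddCommGroup D] [Module k D] [Coalgebra k D] [Coalgebra.IsCocomm k D]
    (t : D →ₗc[k] T) (n : D →ₗc[k] N),
    iT.toCoalgHom.comp t ⊙ iN.toCoalgHom.comp n = iN.toCoalgHom.comp n ⊙ iT.toCoalgHom.comp t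

namespace Splitting

variable {iN : N →ₐc[k] H} {iT : T →ₐc[k] H} (S : Splitting iN iT)
variable {D : Type} [AddCommGroup D] [Module k D] [Coalgebra k D] [Coalgebra.IsCocomm k D]

include S in
theorem mul_mul_mul (n n' : D →ₗc[k] N) (t t' : D →ₗc[k] T) :
    (iN.toCoalgHom.comp n ⊙ iT.toCoalgHom.comp t)
        ⊙ (iN.toCoalgHom.comp n' ⊙ iT.toCoalgHom.comp t')
      = iN.toCoalgHom.comp (n ⊙ n') ⊙ iT.toCoalgHom.comp (t ⊙ t') := by
  rw [comp_pmul, comp_pmul, pmul_assoc, ← pmul_assoc (iT.toCoalgHom.comp t), S.commute]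
  simp only [pmul_assoc]

theorem projN_iN (n : D →ₗc[k] N) : S.projN.comp (iN.toCoalgHom.comp n) = n := by
  simpa only [comp_pone, pmul_pone] using S.projN_comp n (pone k D T)

theorem projT_iN (n : D →ₗc[k] N) : S.projT.comp (iN.toCoalgHom.comp n) = pone k D T := by
  simpa only [comp_pone, pmul_pone] using S.projT_comp n (pone k D T)

theorem projN_iT (t : D →ₗc[k] T) : S.projN.comp (iT.toCoalgHom.comp t) = pone k D N := by
  simpa only [comp_pone, pone_pmul] using S.projN_comp (pone k D N) t

theorem projT_iT (t : D →ₗc[k] T) : S.projT.comp (iT.toCoalgHom.comp t) = t := by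
  simpa only [comp_pone, pone_pmul] using S.projT_comp (pone k D N) t

theorem projN_pone : S.projN.comp (pone k D H) = pone k D N := by
  simpa only [comp_pone, pone_pmul] using S.projN_comp (pone k D N) (pone k D T)

theorem projT_pone : S.projT.comp (pone k D H) = pone k D T := by
  simpa only [comp_pone, pone_pmul] using S.projT_comp (pone k D N) (pone k D T)

theorem projN_pmul (x y : D →ₗc[k] H) :
    S.projN.comp (x ⊙ y) = S.projN.comp x ⊙ S.projN.comp y := by
  obtain ⟨n, t, rfl⟩ := S.exists_eq x
  obtain ⟨n', t', rfl⟩ := S.exists_eq y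
  rw [S.mul_mul_mul, S.projN_comp, S.projN_comp, S.projN_comp]

theorem projT_pmul (x y : D →ₗc[k] H) :
    S.projT.comp (x ⊙ y) = S.projT.comp x ⊙ S.projT.comp y := by
  obtain ⟨n, t, rfl⟩ := S.exists_eq x
  obtain ⟨n', t', rfl⟩ := S.exists_eq y
  rw [S.mul_mul_mul, S.projT_comp, S.projT_comp, S.projT_comp]

end Splitting

variable [Coalgebra.IsCocomm k T] [Coalgebra.IsCocomm k N]

theorem IsSmashProduct.isCocomm {iN : N →ₐc[k] H} {iT : T →ₐc[k] H}
    (h : IsSmashProduct (dropL T N) iN iT) : Coalgebra.IsCocomm k H :=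
  isCocomm_of_surjective (smashHom iN iT) h.bij.surjective

theorem IsSmashProduct.nonempty_splitting {iN : N →ₐc[k] H} {iT : T →ₐc[k] H}
    (h : IsSmashProduct (dropL T N) iN iT) : Nonempty (Splitting iN iT) := by
  let e := CoalgEquiv.ofBijective (f := smashHom iN iT) h.bij
  have hes : e.symm.toCoalgHom.comp (smashHom iN iT) = CoalgHom.id k _ :=
    CoalgHom.ext e.symm_apply_apply
  have hse : (smashHom iN iT).comp e.symm.toCoalgHom = CoalgHom.id k _ :=
    CoalgHom.ext e.apply_symm_apply
  refine ⟨(fstHom k N T).comp e.symm.toCoalgHom, (sndHom k N T).comp e.symm.toCoalgHom,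
    fun n t => ?_, fun n t => ?_, fun x => ?_, fun t n => ?_⟩
  · rw [← smashHom_comp_pair, CoalgHom.comp_assoc, ← CoalgHom.comp_assoc _ (smashHom iN iT), hes,
      CoalgHom.id_comp, fstHom_comp_pair]
  · rw [← smashHom_comp_pair, CoalgHom.comp_assoc, ← CoalgHom.comp_assoc _ (smashHom iN iT), hes,
      CoalgHom.id_comp, sndHom_comp_pair]
  · refine ⟨(fstHom k N T).comp (e.symm.toCoalgHom.comp x),
      (sndHom k N T).comp (e.symm.toCoalgHom.comp x), ?_⟩
    rw [← smashHom_comp_pair, pair_eta, ← CoalgHom.comp_assoc, hse, CoalgHom.id_comp]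
  · rw [← smashHom_comp_pair]
    apply coalgHom_ext
    have hst := h.straighten
    rw [smashCross_dropL] at hst
    have hcomm := congrArg (· ∘ₗ (pair t n).toLinearMap) hst
    simp only [LinearMap.comp_assoc, comm_comp_pair] at hcomm
    rw [pmul, ← map_comp_pair]
    exact hcomm

end Smash

section Decomposition

variable {k : Type} [Field k]
variable {A : Type} [CommRing A] [Algebra k A]
variable {H T N : Type} [Ring H] [Bialgebra k H] [Coalgebra.IsCocomm k H]
  [Ring T] [Bialgebra k T] [Coalgebra.IsCocomm k T]
  [Ring N] [Bialgebra k N] [Coalgebra.IsCocomm k N]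

local notation:70 x:70 "⊙" y:71 => pmul x y

/-- The restriction of a 2-cochain along a bialgebra map. -/
noncomputable def restrict (i : T →ₐc[k] H) : Reg k (H ⊗[k] H) A →+ Reg k (T ⊗[k] T) A :=
  Reg.pull (Coalgebra.TensorProduct.map i.toCoalgHom i.toCoalgHom)

/-- The map `F ↦ F̃` on convolution-invertible 2-cochains. -/
noncomputable def tilde (iN : N →ₐc[k] H) (iT : T →ₐc[k] H) (F : Reg k (H ⊗[k] H) A) :
    Reg k (T ⊗[k] N) A :=
  Reg.pull (Coalgebra.TensorProduct.map iT.toCoalgHom iN.toCoalgHom) F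
    + Reg.pull ((Coalgebra.TensorProduct.map iN.toCoalgHom iT.toCoalgHom).comp
        (pair (sndHom k T N) (fstHom k T N))) (-F)

theorem resTT_toLin (iT : T →ₐc[k] H) (F : Reg k (H ⊗[k] H) A) :
    resTT iT F.toLin = (restrict iT F).toLin := rfl

theorem resNN_toLin (iN : N →ₐc[k] H) (F : Reg k (H ⊗[k] H) A) :
    resNN iN F.toLin = (restrict iN F).toLin := rfl

theorem tildeMap_toLin (iN : N →ₐc[k] H) (iT : T →ₐc[k] H) (F : Reg k (H ⊗[k] H) A) :
    tildeMap iN iT F.toLin (-F).toLin = (tilde iN iT F).toLin := by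
  have h : (pair (sndHom k T N) (fstHom k T N)).toLinearMap
      = (TensorProduct.comm k T N).toLinearMap := by
    rw [← comm_comp_pair, pair_fstHom_sndHom]
    rfl
  rw [tildeMap, ← h]
  rfl

section Values

variable {D : Type} [AddCommGroup D] [Module k D] [Coalgebra k D] [Coalgebra.IsCocomm k D]

theorem restrict_ev (i : T →ₐc[k] H) (F : Reg k (H ⊗[k] H) A) (x y : D →ₗc[k] T) :
    (restrict i F).ev x y = F.ev (i.toCoalgHom.comp x) (i.toCoalgHom.comp y) :=
  Reg.ev_pull_map _ _ _ _ _

theorem tilde_ev (iN : N →ₐc[k] H) (iT : T →ₐc[k] H) (F : Reg k (H ⊗[k] H) A)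
    (t : D →ₗc[k] T) (n : D →ₗc[k] N) :
    (tilde iN iT F).ev t n = F.ev (iT.toCoalgHom.comp t) (iN.toCoalgHom.comp n)
      - F.ev (iN.toCoalgHom.comp n) (iT.toCoalgHom.comp t) := by
  rw [tilde, Reg.add_ev, Reg.ev_pull_map, Reg.ev, Reg.ev, Reg.pull_pull, CoalgHom.comp_assoc,
    pair_comp, sndHom_comp_pair, fstHom_comp_pair, map_comp_pair, map_neg, sub_eq_add_neg]
  rfl

end Values

theorem tilde_add (iN : N →ₐc[k] H) (iT : T →ₐc[k] H) (F F' : Reg k (H ⊗[k] H) A) :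
    tilde iN iT (F + F') = tilde iN iT F + tilde iN iT F' := by
  rw [tilde, tilde, tilde, neg_add, map_add, map_add]
  abel

namespace IsCocycle

variable {F : Reg k (H ⊗[k] H) A} (hF : IsCocycle F)

include hF

theorem restrict (i : T →ₐc[k] H) : IsCocycle (restrict i F) where
  one_left x := by rw [restrict_ev, comp_pone, hF.one_left]
  one_right x := by rw [restrict_ev, comp_pone, hF.one_right]
  cocycle x y z := by
    simp only [restrict_ev, comp_pmul]
    exact hF.cocycle _ _ _

variable {D : Type} [AddCommGroup D] [Module k D] [Coalgebra k D] [Coalgebra.IsCocomm k D]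

theorem ev_pmul_sub_ev_pmul {x y z : D →ₗc[k] H} (hy : x ⊙ y = y ⊙ x) (hz : x ⊙ z = z ⊙ x) :
    F.ev x (y ⊙ z) - F.ev (y ⊙ z) x
      = (F.ev x y - F.ev y x) + (F.ev x z - F.ev z x) := by
  have h1 := hF.cocycle x y z
  have h2 := hF.cocycle y x z
  have h3 := hF.cocycle y z x
  rw [hy] at h1
  rw [hz] at h2
  linear_combination (norm := abel) h2 - h1 - h3

theorem ev_pmul_pmul (n n' t t' : D →ₗc[k] H) (h : t ⊙ n' = n' ⊙ t) :
    F.ev (n ⊙ t) (n' ⊙ t') + F.ev n t + F.ev n' t'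
      = F.ev n n' + F.ev t t' + F.ev (n ⊙ n') (t ⊙ t') + (F.ev t n' - F.ev n' t) := by
  have h1 := hF.cocycle (n ⊙ t) n' t'
  have h2 := hF.cocycle n t n'
  have h3 := hF.cocycle n n' t
  have h4 := hF.cocycle (n ⊙ n') t t'
  rw [pmul_assoc n t n', h, ← pmul_assoc] at h1
  rw [h] at h2
  linear_combination (norm := abel) h2 - h1 - h3 + h4

theorem tilde {iN : N →ₐc[k] H} {iT : T →ₐc[k] H} (S : Splitting iN iT) :
    IsBimultiplicative (tilde iN iT F) where
  one_left n := by rw [tilde_ev, comp_pone, hF.one_left, hF.one_right, sub_zero]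
  one_right t := by rw [tilde_ev, comp_pone, hF.one_left, hF.one_right, sub_zero]
  mul_left t s n := by
    have h := hF.ev_pmul_sub_ev_pmul (S.commute t n).symm (S.commute s n).symm
    rw [tilde_ev, tilde_ev, tilde_ev, comp_pmul]
    linear_combination (norm := abel) -h
  mul_right t n n' := by
    rw [tilde_ev, tilde_ev, tilde_ev, comp_pmul]
    exact hF.ev_pmul_sub_ev_pmul (S.commute t n) (S.commute t n')

end IsCocycle

theorem cohomologous2_refl (F : Reg k (H ⊗[k] H) A) : Cohomologous2 F.toLin F.toLin :=
  (cohomologous2_iff F F).2 ⟨0, fun _ => map_zero _, fun _ _ _ _ _ x y => by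
    simp only [map_zero, neg_zero, add_zero]⟩

theorem Cohomologous2.restrict {F F' : Reg k (H ⊗[k] H) A} (h : Cohomologous2 F.toLin F'.toLin)
    (i : T →ₐc[k] H) : Cohomologous2 (restrict i F).toLin (restrict i F').toLin := by
  obtain ⟨t, ht, h⟩ := (cohomologous2_iff F F').1 h
  refine (cohomologous2_iff _ _).2 ⟨Reg.pull i.toCoalgHom t, fun D _ _ _ _ => ?_,
    fun D _ _ _ _ x y => ?_⟩
  · rw [Reg.pull_pull, comp_pone, ht]
  · rw [restrict_ev, restrict_ev, Reg.pull_pull, Reg.pull_pull, Reg.pull_pull, comp_pmul]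
    exact h D _ _

theorem Cohomologous2.tilde_eq {F F' : Reg k (H ⊗[k] H) A} {iN : N →ₐc[k] H} {iT : T →ₐc[k] H}
    (h : Cohomologous2 F.toLin F'.toLin) (S : Splitting iN iT) :
    tilde iN iT F = tilde iN iT F' := by
  obtain ⟨t, -, h⟩ := (cohomologous2_iff F F').1 h
  apply Reg.ext_ev
  intro D _ _ _ _ x y
  rw [tilde_ev, tilde_ev, h, h, S.commute]
  abel

theorem Splitting.cohomologous2 {F F' : Reg k (H ⊗[k] H) A} (hF : IsCocycle F)
    (hF' : IsCocycle F') {iN : N →ₐc[k] H} {iT : T →ₐc[k] H} (S : Splitting iN iT)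
    (hT : Cohomologous2 (restrict iT F).toLin (restrict iT F').toLin)
    (hP : tilde iN iT F = tilde iN iT F')
    (hN : Cohomologous2 (restrict iN F).toLin (restrict iN F').toLin) :
    Cohomologous2 F.toLin F'.toLin := by
  obtain ⟨α, hα, hT⟩ := (cohomologous2_iff _ _).1 hT
  obtain ⟨β, hβ, hN⟩ := (cohomologous2_iff _ _).1 hN
  let h : Reg k H A := Reg.pull S.projN β + Reg.pull S.projT α
    + (F' - F).ev (iN.toCoalgHom.comp S.projN) (iT.toCoalgHom.comp S.projT)
  have hh (D : Type) [AddCommGroup D] [Module k D] [Coalgebra k D] [Coalgebra.IsCocomm k D]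
      (z : D →ₗc[k] H) : Reg.pull z h
        = Reg.pull (S.projN.comp z) β + Reg.pull (S.projT.comp z) α
          + (F'.ev (iN.toCoalgHom.comp (S.projN.comp z)) (iT.toCoalgHom.comp (S.projT.comp z))
            - F.ev (iN.toCoalgHom.comp (S.projN.comp z)) (iT.toCoalgHom.comp (S.projT.comp z))) := by
    simp only [h, map_add, map_sub, Reg.pull_pull, Reg.pull_ev, Reg.sub_ev, CoalgHom.comp_assoc]
  refine (cohomologous2_iff F F').2 ⟨h, fun D _ _ _ _ => ?_, fun D _ _ _ _ x y => ?_⟩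
  · rw [hh, S.projN_pone, S.projT_pone, hα, hβ, comp_pone, hF.one_left, hF'.one_left, sub_zero,
      add_zero, add_zero]
  · obtain ⟨n, t, rfl⟩ := S.exists_eq x
    obtain ⟨n', t', rfl⟩ := S.exists_eq y
    have h1 := hF.ev_pmul_pmul (iN.toCoalgHom.comp n) (iN.toCoalgHom.comp n')
      (iT.toCoalgHom.comp t) (iT.toCoalgHom.comp t') (S.commute t n')
    have h2 := hF'.ev_pmul_pmul (iN.toCoalgHom.comp n) (iN.toCoalgHom.comp n')
      (iT.toCoalgHom.comp t) (iT.toCoalgHom.comp t') (S.commute t n')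
    have h3 := hT D t t'
    have h4 := hN D n n'
    have h5 := congrArg (fun P => P.ev t n') hP
    simp only [restrict_ev] at h3 h4
    simp only [tilde_ev] at h5
    simp only [hh, S.mul_mul_mul, S.projN_comp, S.projT_comp]
    simp only [comp_pmul]
    linear_combination (norm := abel) h1 - h2 + h3 + h4 + h5

/-- The 2-cochain `(n t, n' t') ↦ gT(t, t') P(t, n') gN(n, n')`. -/
noncomputable def Splitting.glue {iN : N →ₐc[k] H} {iT : T →ₐc[k] H} (S : Splitting iN iT)
    (gT : Reg k (T ⊗[k] T) A) (P : Reg k (T ⊗[k] N) A) (gN : Reg k (N ⊗[k] N) A) :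
    Reg k (H ⊗[k] H) A :=
  Reg.pull (Coalgebra.TensorProduct.map S.projT S.projT) gT
    + Reg.pull (Coalgebra.TensorProduct.map S.projT S.projN) P
    + Reg.pull (Coalgebra.TensorProduct.map S.projN S.projN) gN

namespace Splitting

variable {iN : N →ₐc[k] H} {iT : T →ₐc[k] H} (S : Splitting iN iT)
  {gT : Reg k (T ⊗[k] T) A} {P : Reg k (T ⊗[k] N) A} {gN : Reg k (N ⊗[k] N) A}

theorem glue_ev {D : Type} [AddCommGroup D] [Module k D] [Coalgebra k D] [Coalgebra.IsCocomm k D]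
    (x y : D →ₗc[k] H) :
    (S.glue gT P gN).ev x y = gT.ev (S.projT.comp x) (S.projT.comp y)
      + P.ev (S.projT.comp x) (S.projN.comp y) + gN.ev (S.projN.comp x) (S.projN.comp y) := by
  simp only [glue, Reg.add_ev, Reg.ev_pull_map]

theorem isCocycle_glue (hT : IsCocycle gT) (hP : IsBimultiplicative P) (hN : IsCocycle gN) :
    IsCocycle (S.glue gT P gN) where
  one_left x := by
    rw [glue_ev, projT_pone, projN_pone, hT.one_left, hP.one_left, hN.one_left, add_zero, add_zero]
  one_right x := by
    rw [glue_ev, projT_pone, projN_pone, hT.one_right, hP.one_right, hN.one_right, add_zero,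
      add_zero]
  cocycle x y z := by
    simp only [glue_ev, projT_pmul, projN_pmul, hP.mul_left, hP.mul_right]
    linear_combination (norm := abel)
      hT.cocycle (S.projT.comp x) (S.projT.comp y) (S.projT.comp z)
        + hN.cocycle (S.projN.comp x) (S.projN.comp y) (S.projN.comp z)

theorem restrict_iT_glue (hP : IsBimultiplicative P) (hN : IsCocycle gN) :
    restrict iT (S.glue gT P gN) = gT := by
  apply Reg.ext_ev
  intro D _ _ _ _ x y
  rw [restrict_ev, glue_ev, projT_iT, projT_iT, projN_iT, projN_iT, hP.one_right, hN.one_right,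
    add_zero, add_zero]

theorem restrict_iN_glue (hT : IsCocycle gT) (hP : IsBimultiplicative P) :
    restrict iN (S.glue gT P gN) = gN := by
  apply Reg.ext_ev
  intro D _ _ _ _ x y
  rw [restrict_ev, glue_ev, projT_iN, projT_iN, projN_iN, projN_iN, hT.one_left, hP.one_left,
    zero_add, zero_add]

theorem tilde_glue (hT : IsCocycle gT) (hP : IsBimultiplicative P) (hN : IsCocycle gN) :
    tilde iN iT (S.glue gT P gN) = P := by
  apply Reg.ext_ev
  intro D _ _ _ _ x y
  rw [tilde_ev, glue_ev, glue_ev, projT_iT, projT_iN, projN_iN, projN_iT, hT.one_left,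
    hT.one_right, hP.one_left, hN.one_left, hN.one_right, sub_eq_add_neg]
  abel

end Splitting

end Decomposition

end SmashPaper

/-- **Corollary (`H²(N ⊗ T, A) ≅ H²(T,A) ⊕ H¹_meas(T,Hom(N,A)) ⊕ H²(N,A)`).**
Let `N` and `T` be cocommutative Hopf algebras over `k` and `A` a commutative
`k`-algebra, a trivial module.  For the tensor product Hopf algebra `H = N ⊗ T`
(the smash product along the trivial action `μ(t ⊗ n) = ε(t) n`), there is a canonical
isomorphism `H²(H,A) ≅ H²(T,A) ⊕ H¹_meas(T,Hom(N,A)) ⊕ H²(N,A)`, given explicitly by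
`[f] ↦ ([f|_{T⊗T}], f̃, [f|_{N⊗N}])` where
`f̃(t ⊗ n) = ∑ f(t₍₁₎ ⊗ n₍₁₎) f⁻¹(n₍₂₎ ⊗ t₍₂₎)`.
This is stated elementwise: the three components of a 2-cocycle are cocycles of the
respective complexes, the assignment is compatible with convolution, and it induces a
bijection on cohomology classes. -/
theorem H2_of_tensor_product_decomposition
    {k : Type} [Field k] {T N H A : Type}
    [Ring T] [HopfAlgebra k T] [Ring N] [HopfAlgebra k N]
    [Ring H] [HopfAlgebra k H] [CommRing A] [Algebra k A]
    (hTcc : IsCocomm k T) (hNcc : IsCocomm k N)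
    (iN : N →ₐc[k] H) (iT : T →ₐc[k] H)
    (hsmash : IsSmashProduct (dropL T N) iN iT) :
    -- the three components of a 2-cocycle are cocycles
    (∀ f finv : H ⊗[k] H →ₗ[k] A, IsZ2 f → IsConvInv f finv →
      IsZ2 (resTT iT f) ∧ IsMeasZ1 (dropL T N) (tildeMap iN iT f finv)
        ∧ IsZ2 (resNN iN f))
    -- compatibility with convolution products
    ∧ (∀ f finv f' finv' : H ⊗[k] H →ₗ[k] A,
        IsZ2 f → IsConvInv f finv → IsZ2 f' → IsConvInv f' finv' →
          resTT iT (conv f f') = conv (resTT iT f) (resTT iT f')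
          ∧ tildeMap iN iT (conv f f') (conv finv finv')
              = conv (tildeMap iN iT f finv) (tildeMap iN iT f' finv')
          ∧ resNN iN (conv f f') = conv (resNN iN f) (resNN iN f'))
    -- injectivity on classes
    ∧ (∀ f finv f' finv' : H ⊗[k] H →ₗ[k] A,
        IsZ2 f → IsConvInv f finv → IsZ2 f' → IsConvInv f' finv' →
          (Cohomologous2 f f' ↔
            (Cohomologous2 (resTT iT f) (resTT iT f')
              ∧ (∃ b, IsMeasB1 (dropL T N) b
                  ∧ tildeMap iN iT f finv = conv (tildeMap iN iT f' finv') b)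
              ∧ Cohomologous2 (resNN iN f) (resNN iN f'))))
    -- surjectivity on classes
    ∧ (∀ (gT : T ⊗[k] T →ₗ[k] A) (p : T ⊗[k] N →ₗ[k] A) (gN : N ⊗[k] N →ₗ[k] A),
        IsZ2 gT → IsMeasZ1 (dropL T N) p → IsZ2 gN →
          ∃ f finv : H ⊗[k] H →ₗ[k] A, IsZ2 f ∧ IsConvInv f finv
            ∧ Cohomologous2 (resTT iT f) gT
            ∧ (∃ b, IsMeasB1 (dropL T N) b ∧ tildeMap iN iT f finv = conv p b)
            ∧ Cohomologous2 (resNN iN f) gN) := by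
  have := hTcc.toIsCocomm
  have := hNcc.toIsCocomm
  have := hsmash.isCocomm
  obtain ⟨S⟩ := hsmash.nonempty_splitting
  refine ⟨?_, ?_, ?_, ?_⟩
  · intro f finv hf hinv
    obtain ⟨F, rfl, rfl⟩ := hinv.exists_reg
    have hF := (isZ2_iff F).1 hf
    rw [resTT_toLin, resNN_toLin, tildeMap_toLin]
    exact ⟨(isZ2_iff _).2 (hF.restrict iT), (isMeasZ1_iff _).2 (hF.tilde S),
      (isZ2_iff _).2 (hF.restrict iN)⟩
  · intro f finv f' finv' _ hinv _ hinv'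
    obtain ⟨F, rfl, rfl⟩ := hinv.exists_reg
    obtain ⟨F', rfl, rfl⟩ := hinv'.exists_reg
    rw [← Reg.toLin_add, ← Reg.toLin_add, ← neg_add]
    simp only [resTT_toLin, resNN_toLin, tildeMap_toLin, ← Reg.toLin_add, map_add, tilde_add,
      and_self]
  · intro f finv f' finv' hf hinv hf' hinv'
    obtain ⟨F, rfl, rfl⟩ := hinv.exists_reg
    obtain ⟨F', rfl, rfl⟩ := hinv'.exists_reg
    simp only [resTT_toLin, resNN_toLin, tildeMap_toLin, exists_isMeasB1_iff]
    exact ⟨fun h => ⟨h.restrict iT, h.tilde_eq S, h.restrict iN⟩,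
      fun h => S.cohomologous2 ((isZ2_iff F).1 hf) ((isZ2_iff F').1 hf') h.1 h.2.1 h.2.2⟩
  · intro gT p gN hgT hp hgN
    obtain ⟨gT, rfl⟩ := isConvInvertible_iff.1 hgT.2.1
    obtain ⟨p, rfl⟩ := isConvInvertible_iff.1 hp.1.2.2
    obtain ⟨gN, rfl⟩ := isConvInvertible_iff.1 hgN.2.1
    have hT := (isZ2_iff gT).1 hgT
    have hP := (isMeasZ1_iff p).1 hp
    have hN := (isZ2_iff gN).1 hgN
    refine ⟨(S.glue gT p gN).toLin, (-S.glue gT p gN).toLin,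
      (isZ2_iff _).2 (S.isCocycle_glue hT hP hN), Reg.isConvInv _, ?_, ?_, ?_⟩
    · rw [resTT_toLin, S.restrict_iT_glue hP hN]
      exact cohomologous2_refl gT
    · rw [tildeMap_toLin, S.tilde_glue hT hP hN]
      exact (exists_isMeasB1_iff p p).2 rfl
    · rw [resNN_toLin, S.restrict_iN_glue hT hP]
      exact cohomologous2_refl gN
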